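/- One-point function ⟨E^{1,1}⟩ of the integrable spin-1 XXZ chain (explicit evaluation): Let 0 < ζ < π/2, put η = iζ and ρ(x) = 1/(2ζ cosh(πx/ζ)). Define K₁ = ∫_ℝ ρ(x) dx, K₂ = −2 cos ζ ∫_ℝ ρ(x) sinh(x−η/2)/sinh(x+η/2) dx, and for ε > 0 the double integrals J₁(ε) = −∫_ℝ∫_ℝ [sinh(x₁−3η/2) sinh(x₂−η/2) / (sinh η · sinh(x₂−x₁−iε))] ρ(x₁) ρ(x₂) dx₁ dx₂ and J₂(ε) = −∫_ℝ∫_ℝ [sinh(x₁−5η/2) sinh(x₂+η/2) / (sinh η · sinh(x₂−x₁+2η+iε))] ρ(x₁) ρ(x₂) dx₁ dx₂. Then 2(−K₁ + K₂ + J₁(ε) − J₂(ε)) tends, as ε → 0⁺, to cos ζ (sin ζ − ζ cos ζ)/(ζ sin² ζ). -/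

import Mathlib

open MeasureTheory Filter

/-- The density of string centers. -/
noncomputable def rho (ζ x : ℝ) : ℝ := 1 / (2 * ζ * Real.cosh (Real.pi * x / ζ))

open Topology Complex

/-! ### Bounds on complex hyperbolic functions -/

lemma sq_norm_sinh (z : ℂ) :
    ‖Complex.sinh z‖ ^ 2 = Real.sinh z.re ^ 2 + Real.sin z.im ^ 2 := by
  rw [← Complex.normSq_eq_norm_sq]
  conv_lhs => rw [← Complex.re_add_im z]
  rw [Complex.sinh_add, Complex.cosh_mul_I, Complex.sinh_mul_I]
  simp only [← Complex.ofReal_sinh, ← Complex.ofReal_cosh, ← Complex.ofReal_cos,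
    ← Complex.ofReal_sin, ← mul_assoc, ← Complex.ofReal_mul]
  rw [Complex.normSq_add_mul_I]
  nlinarith [Real.cosh_sq z.re, Real.sin_sq_add_cos_sq z.im]

lemma sq_norm_cosh (z : ℂ) :
    ‖Complex.cosh z‖ ^ 2 = Real.sinh z.re ^ 2 + Real.cos z.im ^ 2 := by
  rw [← Complex.normSq_eq_norm_sq]
  conv_lhs => rw [← Complex.re_add_im z]
  rw [Complex.cosh_add, Complex.cosh_mul_I, Complex.sinh_mul_I]
  simp only [← Complex.ofReal_sinh, ← Complex.ofReal_cosh, ← Complex.ofReal_cos,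
    ← Complex.ofReal_sin, ← mul_assoc, ← Complex.ofReal_mul]
  rw [Complex.normSq_add_mul_I]
  nlinarith [Real.cosh_sq z.re, Real.sin_sq_add_cos_sq z.im]

lemma abs_sin_im_le_norm_sinh (z : ℂ) : |Real.sin z.im| ≤ ‖Complex.sinh z‖ := by
  refine abs_le_of_sq_le_sq ?_ (norm_nonneg _)
  rw [sq_norm_sinh]
  nlinarith [sq_nonneg (Real.sinh z.re)]

lemma abs_sinh_re_le_norm_cosh (z : ℂ) : |Real.sinh z.re| ≤ ‖Complex.cosh z‖ := by
  refine abs_le_of_sq_le_sq ?_ (norm_nonneg _)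
  rw [sq_norm_cosh]
  nlinarith [sq_nonneg (Real.cos z.im)]

lemma cosh_le_exp_abs (x : ℝ) : Real.cosh x ≤ Real.exp |x| := by
  rw [← Real.cosh_abs, Real.cosh_eq]
  have : Real.exp (-|x|) ≤ Real.exp |x| := Real.exp_le_exp.mpr (by linarith [abs_nonneg x])
  linarith

lemma norm_sinh_le_exp_abs_re (z : ℂ) : ‖Complex.sinh z‖ ≤ Real.exp |z.re| := by
  refine le_trans ?_ (cosh_le_exp_abs z.re)
  refine (sq_le_sq₀ (norm_nonneg _) (Real.cosh_pos _).le).mp ?_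
  rw [sq_norm_sinh]
  nlinarith [Real.cosh_sq z.re, Real.sin_sq_add_cos_sq z.im, sq_nonneg (Real.cos z.im)]

lemma exp_abs_div_two_le_cosh (x : ℝ) : Real.exp |x| / 2 ≤ Real.cosh x := by
  rw [← Real.cosh_abs, Real.cosh_eq]
  linarith [Real.exp_pos (-|x|)]

lemma exp_abs_div_four_le_abs_sinh {x : ℝ} (hx : 1 ≤ |x|) :
    Real.exp |x| / 4 ≤ |Real.sinh x| := by
  rw [Real.abs_sinh, Real.sinh_eq]
  have h1 : Real.exp (-|x|) ≤ 1 := Real.exp_le_one_iff.mpr (by linarith)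
  have h2 := Real.add_one_le_exp |x|
  linarith

/-! ### Integrals of exponentially decaying functions -/

lemma integrable_exp_neg_mul_abs {δ : ℝ} (hδ : 0 < δ) :
    Integrable fun x : ℝ => Real.exp (-δ * |x|) := by
  rw [← integrableOn_univ, ← Set.Iic_union_Ioi (a := (0 : ℝ))]
  refine IntegrableOn.union ?_ ?_
  · refine (integrableOn_exp_mul_Iic hδ 0).congr_fun (fun x hx => ?_) measurableSet_Iic
    simp [abs_of_nonpos (Set.mem_Iic.mp hx)]
  · refine (exp_neg_integrableOn_Ioi 0 hδ).congr_fun (fun x hx => ?_) measurableSet_Ioi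
    simp [abs_of_pos (Set.mem_Ioi.mp hx)]

lemma integrable_of_norm_le_exp {f : ℝ → ℂ} (hf : Continuous f) {C δ : ℝ} (hδ : 0 < δ)
    (hb : ∀ x : ℝ, 1 ≤ |x| → ‖f x‖ ≤ C * Real.exp (-δ * |x|)) : Integrable f := by
  refine hf.locallyIntegrable.integrable_of_isBigO_cocompact (g := fun x => Real.exp (-δ * |x|))
    ?_ ((integrable_exp_neg_mul_abs hδ).integrableAtFilter _)
  refine Asymptotics.IsBigO.of_bound C ?_
  have : ∀ᶠ x : ℝ in cocompact ℝ, 1 ≤ ‖x‖ := tendsto_norm_cocompact_atTop.eventually_ge_atTop 1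
  filter_upwards [this] with x hx
  rw [Real.norm_eq_abs, Real.abs_exp]
  exact hb x hx

/-- Cauchy's theorem on a horizontal strip, for exponentially decaying functions. -/
lemma integral_eq_integral_add_mul_I {f : ℂ → ℂ} {h C δ : ℝ} (hh : 0 ≤ h) (hδ : 0 < δ)
    (hd : ∀ z : ℂ, 0 ≤ z.im → z.im ≤ h → DifferentiableAt ℂ f z)
    (hb : ∀ z : ℂ, 0 ≤ z.im → z.im ≤ h → 1 ≤ |z.re| → ‖f z‖ ≤ C * Real.exp (-δ * |z.re|)) :
    Integrable (fun x : ℝ => f x) ∧ Integrable (fun x : ℝ => f (x + h * I)) ∧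
    ∫ x : ℝ, f x = ∫ x : ℝ, f (x + h * I) := by
  have hline : ∀ y : ℝ, 0 ≤ y → y ≤ h → Integrable (fun x : ℝ => f (x + y * I)) := by
    intro y hy0 hy1
    refine integrable_of_norm_le_exp (C := C) (δ := δ) ?_ hδ ?_
    · refine continuous_iff_continuousAt.mpr fun x => ?_
      exact ContinuousAt.comp (f := fun x : ℝ => (x + y * I : ℂ))
        (hd _ (by simpa using hy0) (by simpa using hy1)).continuousAt (by fun_prop)
    · intro x hx
      simpa using hb (x + y * I) (by simpa using hy0) (by simpa using hy1) (by simpa using hx)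
  have hi0 : Integrable (fun x : ℝ => f x) := by simpa using hline 0 le_rfl hh
  have hi1 := hline h hh le_rfl
  refine ⟨hi0, hi1, ?_⟩
  have hvert : ∀ s : ℝ, |s| = 1 →
      Tendsto (fun T : ℝ => ∫ y : ℝ in (0:ℝ)..h, f ((s * T : ℝ) + y * I)) atTop (𝓝 0) := by
    intro s hs
    have hlim : Tendsto (fun T : ℝ => C * Real.exp (-δ * T) * |h - 0|) atTop (𝓝 0) := by
      have : Tendsto (fun T : ℝ => Real.exp (-δ * T)) atTop (𝓝 0) :=
        Real.tendsto_exp_atBot.comp (tendsto_id.const_mul_atTop_of_neg (by linarith))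
      simpa using (this.const_mul C).mul_const |h - 0|
    refine squeeze_zero_norm' ?_ hlim
    filter_upwards [eventually_ge_atTop 1] with T hT
    refine intervalIntegral.norm_integral_le_of_norm_le_const fun y hy => ?_
    rw [Set.uIoc_of_le hh] at hy
    have habs : |s * T| = T := by rw [abs_mul, hs, one_mul, abs_of_nonneg (by linarith)]
    have := hb ((s * T : ℝ) + y * I) (by simpa using hy.1.le) (by simpa using hy.2)
      (by simpa [habs] using hT)
    simpa [habs] using this
  have hrect : ∀ T : ℝ, (∫ x : ℝ in -T..T, f x) - (∫ x : ℝ in -T..T, f (x + h * I)) +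
      I * (∫ y : ℝ in (0:ℝ)..h, f ((1 * T : ℝ) + y * I)) -
      I * (∫ y : ℝ in (0:ℝ)..h, f ((-1 * T : ℝ) + y * I)) = 0 := by
    intro T
    have := integral_boundary_rect_eq_zero_of_differentiableOn f (-T) (T + h * I) ?_
    · simpa using this
    · intro z hz
      have hz2 := hz.2
      simp [Set.uIcc_of_le hh] at hz2
      exact (hd z hz2.1 hz2.2).differentiableWithinAt
  have l0 := intervalIntegral_tendsto_integral hi0 tendsto_neg_atTop_atBot tendsto_id
  have l1 := intervalIntegral_tendsto_integral hi1 tendsto_neg_atTop_atBot tendsto_id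
  have l2 := ((l0.sub l1).add ((hvert 1 (by simp)).const_mul I)).sub
    ((hvert (-1) (by simp)).const_mul I)
  simp only [id] at l2
  rw [funext hrect] at l2
  have := tendsto_nhds_unique l2 tendsto_const_nhds
  simp only [mul_zero, add_zero, sub_zero] at this
  exact sub_eq_zero.mp this

/-! ### The density and its analytic continuation -/

lemma continuous_rho {ζ : ℝ} (hζ : 0 < ζ) : Continuous (rho ζ) := by
  unfold rho
  refine continuous_const.div (by fun_prop) fun x => ?_
  have := Real.cosh_pos (Real.pi * x / ζ)
  positivity

lemma rho_nonneg {ζ : ℝ} (hζ : 0 < ζ) (x : ℝ) : 0 ≤ rho ζ x := by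
  unfold rho
  have := Real.cosh_pos (Real.pi * x / ζ)
  positivity

lemma rho_le {ζ : ℝ} (hζ : 0 < ζ) (x : ℝ) :
    rho ζ x ≤ 1 / ζ * Real.exp (-(Real.pi / ζ) * |x|) := by
  have h := exp_abs_div_two_le_cosh (Real.pi * x / ζ)
  have habs : |Real.pi * x / ζ| = Real.pi / ζ * |x| := by
    rw [abs_div, abs_mul, abs_of_pos Real.pi_pos, abs_of_pos hζ]; ring
  rw [habs] at h
  have hE := Real.exp_pos (Real.pi / ζ * |x|)
  calc rho ζ x ≤ 1 / (2 * ζ * (Real.exp (Real.pi / ζ * |x|) / 2)) := by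
        unfold rho; gcongr
    _ = _ := by rw [neg_mul, Real.exp_neg]; field_simp

lemma rho_le_inv {ζ : ℝ} (hζ : 0 < ζ) (x : ℝ) : rho ζ x ≤ 1 / ζ := by
  refine (rho_le hζ x).trans (mul_le_of_le_one_right (by positivity) ?_)
  refine Real.exp_le_one_iff.mpr ?_
  have : 0 ≤ Real.pi / ζ * |x| := by have := Real.pi_pos; positivity
  linarith

/-- The integrand `rho` times a function of controlled growth decays exponentially. -/
lemma norm_mul_rho_le {ζ : ℝ} (hζ : 0 < ζ) {w : ℂ} {x C : ℝ}
    (hw : ‖w‖ ≤ C * Real.exp (2 * |x|)) :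
    ‖w * (rho ζ x : ℂ)‖ ≤ C / ζ * Real.exp (-(Real.pi / ζ - 2) * |x|) := by
  rw [norm_mul, Complex.norm_real, Real.norm_of_nonneg (rho_nonneg hζ x)]
  calc ‖w‖ * rho ζ x ≤ (C * Real.exp (2 * |x|)) * (1 / ζ * Real.exp (-(Real.pi / ζ) * |x|)) :=
        mul_le_mul hw (rho_le hζ x) (rho_nonneg hζ x) ((norm_nonneg w).trans hw)
    _ = C / ζ * (Real.exp (2 * |x|) * Real.exp (-(Real.pi / ζ) * |x|)) := by ring
    _ = _ := by rw [← Real.exp_add]; ring_nf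

lemma two_lt_pi_div {ζ : ℝ} (hζ : 0 < ζ) (hζ1 : ζ < Real.pi / 2) : 2 < Real.pi / ζ := by
  rw [lt_div_iff₀ hζ]; linarith

lemma integrable_rho {ζ : ℝ} (hζ : 0 < ζ) : Integrable (rho ζ) := by
  refine Integrable.mono' ((integrable_exp_neg_mul_abs (δ := Real.pi / ζ)
    (by positivity)).const_mul (1 / ζ)) (continuous_rho hζ).aestronglyMeasurable ?_
  refine Eventually.of_forall fun x => ?_
  rw [Real.norm_of_nonneg (rho_nonneg hζ x)]
  exact rho_le hζ x

lemma integral_rho {ζ : ℝ} (hζ : 0 < ζ) : ∫ x, rho ζ x = 1 / 2 := by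
  have hd : ∀ x : ℝ, HasDerivAt
      (fun x => 1 / (2 * Real.pi) * Real.arctan (Real.sinh (Real.pi * x / ζ))) (rho ζ x) x := by
    intro x
    have h1 : HasDerivAt (fun x : ℝ => Real.pi * x / ζ) (Real.pi / ζ) x := by
      simpa using ((hasDerivAt_id x).const_mul Real.pi).div_const ζ
    have h2 := (h1.sinh.arctan).const_mul (1 / (2 * Real.pi))
    refine h2.congr_deriv ?_
    have := Real.cosh_pos (Real.pi * x / ζ)
    have hpi := Real.pi_pos
    have e : 1 + Real.sinh (Real.pi * x / ζ) ^ 2 = Real.cosh (Real.pi * x / ζ) ^ 2 := by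
      rw [Real.cosh_sq]; ring
    rw [e]
    unfold rho
    field_simp
  have hlin : Tendsto (fun x : ℝ => Real.pi * x / ζ) atTop atTop :=
    (tendsto_id.const_mul_atTop Real.pi_pos).atTop_div_const hζ
  have hlin' : Tendsto (fun x : ℝ => Real.pi * x / ζ) atBot atBot :=
    (tendsto_id.const_mul_atBot Real.pi_pos).atBot_div_const hζ
  have hT := ((tendsto_nhds_of_tendsto_nhdsWithin Real.tendsto_arctan_atTop).comp
    (Real.sinhOrderIso.tendsto_atTop.comp hlin)).const_mul (1 / (2 * Real.pi))
  have hB := ((tendsto_nhds_of_tendsto_nhdsWithin Real.tendsto_arctan_atBot).comp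
    (Real.sinhOrderIso.tendsto_atBot.comp hlin')).const_mul (1 / (2 * Real.pi))
  rw [integral_of_hasDerivAt_of_tendsto hd (integrable_rho hζ) hB hT]
  field_simp
  norm_num

lemma tendsto_tanh_atTop : Tendsto Real.tanh atTop (𝓝 1) := by
  have h : Tendsto (fun x : ℝ => Real.exp (-(2 * x))) atTop (𝓝 0) :=
    Real.tendsto_exp_neg_atTop_nhds_zero.comp (tendsto_id.const_mul_atTop two_pos)
  have h2 : Tendsto (fun x : ℝ => (1 - Real.exp (-(2 * x))) / (1 + Real.exp (-(2 * x)))) atTop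
      (𝓝 ((1 - 0) / (1 + 0))) := (h.const_sub 1).div (h.const_add 1) (by norm_num)
  norm_num at h2
  refine h2.congr fun x => ?_
  rw [Real.tanh_eq_sinh_div_cosh, Real.sinh_eq, Real.cosh_eq]
  have e : Real.exp (-(2 * x)) = Real.exp (-x) / Real.exp x := by
    rw [← Real.exp_sub]; ring_nf
  have hx := Real.exp_pos x
  have hx' := Real.exp_pos (-x)
  rw [e]
  field_simp

lemma tendsto_tanh_atBot : Tendsto Real.tanh atBot (𝓝 (-1)) := by
  have := (tendsto_tanh_atTop.comp tendsto_neg_atBot_atTop).neg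
  refine this.congr fun x => ?_
  simp

lemma integrable_rho_sq {ζ : ℝ} (hζ : 0 < ζ) : Integrable fun x => rho ζ x ^ 2 := by
  simp_rw [sq]
  refine (integrable_rho hζ).mul_bdd (c := 1 / ζ) (continuous_rho hζ).aestronglyMeasurable
    (Eventually.of_forall fun x => ?_)
  rw [Real.norm_of_nonneg (rho_nonneg hζ x)]
  exact rho_le_inv hζ x

lemma integral_rho_sq {ζ : ℝ} (hζ : 0 < ζ) : ∫ x, rho ζ x ^ 2 = 1 / (2 * Real.pi * ζ) := by
  have hd : ∀ x : ℝ, HasDerivAt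
      (fun x => 1 / (4 * Real.pi * ζ) * Real.tanh (Real.pi * x / ζ)) (rho ζ x ^ 2) x := by
    intro x
    have h1 : HasDerivAt (fun x : ℝ => Real.pi * x / ζ) (Real.pi / ζ) x := by
      simpa using ((hasDerivAt_id x).const_mul Real.pi).div_const ζ
    have hc := Real.cosh_pos (Real.pi * x / ζ)
    have h2 := (h1.sinh.div h1.cosh hc.ne').const_mul (1 / (4 * Real.pi * ζ))
    have hpi := Real.pi_pos
    have e : (fun x => 1 / (4 * Real.pi * ζ) * Real.tanh (Real.pi * x / ζ)) =
        fun x => 1 / (4 * Real.pi * ζ) *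
          (Real.sinh (Real.pi * x / ζ) / Real.cosh (Real.pi * x / ζ)) := by
      simp_rw [Real.tanh_eq_sinh_div_cosh]
    rw [e]
    refine h2.congr_deriv ?_
    unfold rho
    field_simp
    rw [Real.cosh_sq]
    ring
  have hlin : Tendsto (fun x : ℝ => Real.pi * x / ζ) atTop atTop :=
    (tendsto_id.const_mul_atTop Real.pi_pos).atTop_div_const hζ
  have hlin' : Tendsto (fun x : ℝ => Real.pi * x / ζ) atBot atBot :=
    (tendsto_id.const_mul_atBot Real.pi_pos).atBot_div_const hζ
  have hT := (tendsto_tanh_atTop.comp hlin).const_mul (1 / (4 * Real.pi * ζ))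
  have hB := (tendsto_tanh_atBot.comp hlin').const_mul (1 / (4 * Real.pi * ζ))
  rw [integral_of_hasDerivAt_of_tendsto hd (integrable_rho_sq hζ) hB hT]
  have hpi := Real.pi_pos
  field_simp
  norm_num

/-- The analytic continuation of `rho`. -/
noncomputable def crho (ζ : ℝ) (z : ℂ) : ℂ := 1 / (2 * ζ * Complex.cosh (Real.pi * z / ζ))

lemma crho_ofReal (ζ x : ℝ) : crho ζ x = rho ζ x := by
  simp [crho, rho]

lemma crho_add_mul_I {ζ : ℝ} (hζ : 0 < ζ) (z : ℂ) : crho ζ (z + ζ * I) = -crho ζ z := by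
  have hζ' : (ζ : ℂ) ≠ 0 := by exact_mod_cast hζ.ne'
  have : (Real.pi : ℂ) * (z + ζ * I) / ζ = Real.pi * z / ζ + Real.pi * I := by field_simp
  rw [crho, crho, this, Complex.cosh_add, Complex.cosh_mul_I, Complex.sinh_mul_I]
  simp

lemma norm_crho_le {ζ : ℝ} (hζ : 0 < ζ) (hζ1 : ζ < Real.pi / 2) {z : ℂ} (hz : 1 ≤ |z.re|) :
    ‖crho ζ z‖ ≤ 2 / ζ * Real.exp (-(Real.pi / ζ) * |z.re|) := by
  have hre : ((Real.pi : ℂ) * z / ζ).re = Real.pi / ζ * z.re := by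
    rw [Complex.div_ofReal_re, Complex.re_ofReal_mul]; ring
  have habs : |Real.pi / ζ * z.re| = Real.pi / ζ * |z.re| := by
    rw [abs_mul, abs_of_pos (div_pos Real.pi_pos hζ)]
  have h2 := two_lt_pi_div hζ hζ1
  have h := exp_abs_div_four_le_abs_sinh (x := Real.pi / ζ * z.re) (by rw [habs]; nlinarith)
  have h' := abs_sinh_re_le_norm_cosh ((Real.pi : ℂ) * z / ζ)
  rw [hre] at h'
  rw [habs] at h
  have hE := Real.exp_pos (Real.pi / ζ * |z.re|)
  have hn : ‖crho ζ z‖ = 1 / (2 * ζ * ‖Complex.cosh (Real.pi * z / ζ)‖) := by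
    simp [crho, abs_of_pos hζ]
  rw [hn]
  calc _ ≤ 1 / (2 * ζ * (Real.exp (Real.pi / ζ * |z.re|) / 4)) := by
        gcongr; exact h.trans h'
    _ = _ := by rw [neg_mul, Real.exp_neg]; field_simp; norm_num

lemma cosh_pi_mul_div_ne_zero {ζ : ℝ} (hζ : 0 < ζ) {z : ℂ} (h0 : 0 ≤ z.im) (h1 : z.im ≤ ζ)
    (hz : z ≠ ζ / 2 * I) : Complex.cosh (Real.pi * z / ζ) ≠ 0 := by
  intro h
  have hn := sq_norm_cosh ((Real.pi : ℂ) * z / ζ)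
  rw [h, Complex.div_ofReal_re, Complex.re_ofReal_mul, Complex.div_ofReal_im,
    Complex.im_ofReal_mul] at hn
  simp only [norm_zero] at hn
  have hs : Real.sinh (Real.pi * z.re / ζ) = 0 := by
    nlinarith [sq_nonneg (Real.sinh (Real.pi * z.re / ζ)),
      sq_nonneg (Real.cos (Real.pi * z.im / ζ))]
  have hc : Real.cos (Real.pi * z.im / ζ) = 0 := by
    nlinarith [sq_nonneg (Real.sinh (Real.pi * z.re / ζ)),
      sq_nonneg (Real.cos (Real.pi * z.im / ζ))]
  have hpi := Real.pi_pos
  have hre : z.re = 0 := by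
    rw [Real.sinh_eq_zero] at hs
    field_simp at hs
    simpa [hpi.ne'] using hs
  have him : Real.pi * z.im / ζ = Real.pi / 2 := by
    refine Real.injOn_cos ⟨by positivity, ?_⟩ ⟨by positivity, by linarith⟩ ?_
    · rw [div_le_iff₀ hζ]; gcongr
    · rw [hc, Real.cos_pi_div_two]
  have him' : z.im = ζ / 2 := by
    field_simp at him
    linarith
  apply hz
  apply Complex.ext <;> simp [hre, him']

/-- The function `(g - g (iζ/2)) * crho ζ`, with its removable singularity at `iζ/2` filled in. -/
noncomputable def polarQuotient (ζ : ℝ) (g : ℂ → ℂ) (z : ℂ) : ℂ :=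
  dslope g (ζ / 2 * I) z /
    (2 * ζ * dslope (fun w => Complex.cosh (Real.pi * w / ζ)) (ζ / 2 * I) z)

lemma hasDerivAt_cosh_pi_mul_div {ζ : ℝ} (hζ : 0 < ζ) : HasDerivAt
    (fun w : ℂ => Complex.cosh (Real.pi * w / ζ)) (Real.pi / ζ * I) (ζ / 2 * I) := by
  have h1 : HasDerivAt (fun w : ℂ => (Real.pi : ℂ) * w / ζ) (Real.pi / ζ) (ζ / 2 * I) := by
    simpa using ((hasDerivAt_id ((ζ : ℂ) / 2 * I)).const_mul (Real.pi : ℂ)).div_const (ζ : ℂ)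
  have hζ' : (ζ : ℂ) ≠ 0 := by exact_mod_cast hζ.ne'
  have e : (Real.pi : ℂ) * (ζ / 2 * I) / ζ = Real.pi / 2 * I := by field_simp
  have h2 := h1.ccosh
  rw [e, Complex.sinh_mul_I, Complex.sin_pi_div_two] at h2
  convert h2 using 1
  ring

lemma cosh_pi_mul_div_center {ζ : ℝ} (hζ : 0 < ζ) :
    Complex.cosh (Real.pi * (ζ / 2 * I) / ζ) = 0 := by
  have hζ' : (ζ : ℂ) ≠ 0 := by exact_mod_cast hζ.ne'
  have e : (Real.pi : ℂ) * (ζ / 2 * I) / ζ = Real.pi / 2 * I := by field_simp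
  rw [e, Complex.cosh_mul_I, Complex.cos_pi_div_two]

lemma polarQuotient_of_ne {ζ : ℝ} (hζ : 0 < ζ) (g : ℂ → ℂ) {z : ℂ} (hz : z ≠ ζ / 2 * I) :
    polarQuotient ζ g z = (g z - g (ζ / 2 * I)) * crho ζ z := by
  rw [polarQuotient, dslope_of_ne _ hz, dslope_of_ne _ hz, slope_def_field, slope_def_field,
    cosh_pi_mul_div_center hζ, crho, sub_zero]
  have := sub_ne_zero.mpr hz
  by_cases hc : Complex.cosh (Real.pi * z / ζ) = 0
  · simp [hc]
  · have hζ' : (ζ : ℂ) ≠ 0 := by exact_mod_cast hζ.ne'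
    rw [← mul_div_assoc, div_div_div_cancel_right₀ this, mul_one_div]

lemma polarQuotient_center {ζ : ℝ} (g : ℂ → ℂ) (h : deriv g (ζ / 2 * I) = 0) :
    polarQuotient ζ g (ζ / 2 * I) = 0 := by
  simp [polarQuotient, h]

lemma differentiableAt_dslope {g : ℂ → ℂ} {c z : ℂ} (hg : ∀ᶠ w in 𝓝 c, DifferentiableAt ℂ g w)
    (hz : DifferentiableAt ℂ g z) : DifferentiableAt ℂ (dslope g c) z := by
  by_cases h : z = c
  · subst h
    have hd : DifferentiableOn ℂ g {w | DifferentiableAt ℂ g w} :=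
      fun w hw => DifferentiableAt.differentiableWithinAt hw
    exact ((Complex.differentiableOn_dslope hg).mpr hd).differentiableAt hg
  · exact (differentiableAt_dslope_of_ne h).mpr hz

lemma differentiableAt_polarQuotient {ζ : ℝ} (hζ : 0 < ζ) {g : ℂ → ℂ}
    (hg : ∀ z : ℂ, 0 ≤ z.im → z.im ≤ ζ → DifferentiableAt ℂ g z) {z : ℂ} (h0 : 0 ≤ z.im)
    (h1 : z.im ≤ ζ) : DifferentiableAt ℂ (polarQuotient ζ g) z := by
  have hev : ∀ᶠ w in 𝓝 ((ζ : ℂ) / 2 * I), DifferentiableAt ℂ g w := by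
    have him : ((ζ : ℂ) / 2 * I).im = ζ / 2 := by simp
    have e0 := Complex.continuous_im.continuousAt.eventually
      (lt_mem_nhds (show (0 : ℝ) < ((ζ : ℂ) / 2 * I).im by rw [him]; linarith))
    have e1 := Complex.continuous_im.continuousAt.eventually
      (gt_mem_nhds (show ((ζ : ℂ) / 2 * I).im < ζ by rw [him]; linarith))
    filter_upwards [e0, e1] with w hw0 hw1 using hg w hw0.le hw1.le
  have hζ' : (ζ : ℂ) ≠ 0 := by exact_mod_cast hζ.ne'
  have hpi : (Real.pi : ℂ) ≠ 0 := by exact_mod_cast Real.pi_ne_zero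
  refine (differentiableAt_dslope hev (hg z h0 h1)).div
    ((differentiableAt_dslope (Eventually.of_forall fun w => ?_) ?_).const_mul _) ?_
  · fun_prop
  · fun_prop
  · refine mul_ne_zero (by simpa using hζ') ?_
    by_cases hz : z = ζ / 2 * I
    · rw [hz, dslope_same, (hasDerivAt_cosh_pi_mul_div hζ).deriv]
      simp [hpi, hζ']
    · rw [dslope_of_ne _ hz, slope_def_field, cosh_pi_mul_div_center hζ, sub_zero]
      exact div_ne_zero (cosh_pi_mul_div_ne_zero hζ h0 h1 hz) (sub_ne_zero.mpr hz)

/-- Shifting the contour by `iζ` across the simple pole of the density at `iζ/2`. -/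
lemma integral_rho_mul_add_shift {ζ : ℝ} (hζ : 0 < ζ) (hζ1 : ζ < Real.pi / 2) {g : ℂ → ℂ} {C : ℝ}
    (hg : ∀ z : ℂ, 0 ≤ z.im → z.im ≤ ζ → DifferentiableAt ℂ g z)
    (hb : ∀ z : ℂ, 0 ≤ z.im → z.im ≤ ζ → 1 ≤ |z.re| → ‖g z‖ ≤ C * Real.exp (2 * |z.re|)) :
    (∫ x : ℝ, g x * (rho ζ x : ℂ)) + ∫ x : ℝ, g (x + ζ * I) * (rho ζ x : ℂ) =
      g (ζ / 2 * I) := by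
  set c : ℂ := ζ / 2 * I with hc
  have h2 := two_lt_pi_div hζ hζ1
  have hint : ∀ y : ℝ, 0 ≤ y → y ≤ ζ →
      Integrable fun x : ℝ => g (x + y * I) * (rho ζ x : ℂ) := by
    intro y h0 h1
    refine integrable_of_norm_le_exp (C := C / ζ) (δ := Real.pi / ζ - 2) ?_ (by linarith) ?_
    · refine Continuous.mul (continuous_iff_continuousAt.mpr fun x => ?_)
        (Complex.continuous_ofReal.comp (continuous_rho hζ))
      exact ContinuousAt.comp (f := fun x : ℝ => (x + y * I : ℂ))
        (hg _ (by simpa using h0) (by simpa using h1)).continuousAt (by fun_prop)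
    · intro x hx
      refine norm_mul_rho_le hζ ?_
      simpa using hb (x + y * I) (by simpa using h0) (by simpa using h1) (by simpa using hx)
  have hi0 : Integrable fun x : ℝ => g x * (rho ζ x : ℂ) := by simpa using hint 0 le_rfl hζ.le
  have hi1 := hint ζ hζ.le le_rfl
  have hir : Integrable fun x : ℝ => g c * (rho ζ x : ℂ) :=
    (integrable_rho hζ).ofReal.const_mul _
  have hcr : ∫ x : ℝ, g c * (rho ζ x : ℂ) = g c / 2 := by
    rw [integral_const_mul, integral_complex_ofReal, integral_rho hζ]
    push_cast
    ring
  have hne : ∀ z : ℂ, z.im ≠ ζ / 2 → z ≠ c := by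
    rintro z hz rfl
    simp [hc] at hz
  obtain ⟨-, -, hshift⟩ := integral_eq_integral_add_mul_I (f := polarQuotient ζ g)
    (C := (|C| + ‖g c‖) * (2 / ζ)) (δ := Real.pi / ζ - 2) hζ.le (by linarith)
    (fun z h0 h1 => differentiableAt_polarQuotient hζ hg h0 h1) (by
      intro z h0 h1 hz
      rw [polarQuotient_of_ne hζ _ (by
        rintro rfl
        simp at hz
        norm_num at hz), norm_mul]
      have hE : 1 ≤ Real.exp (2 * |z.re|) := Real.one_le_exp (by positivity)
      have hgz : ‖g z - g c‖ ≤ (|C| + ‖g c‖) * Real.exp (2 * |z.re|) := by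
        refine (norm_sub_le _ _).trans ?_
        rw [add_mul]
        refine add_le_add ((hb z h0 h1 hz).trans ?_) (le_mul_of_one_le_right (norm_nonneg _) hE)
        gcongr
        exact le_abs_self C
      calc _ ≤ ((|C| + ‖g c‖) * Real.exp (2 * |z.re|)) *
            (2 / ζ * Real.exp (-(Real.pi / ζ) * |z.re|)) := by
            gcongr
            exact norm_crho_le hζ hζ1 hz
        _ = (|C| + ‖g c‖) * (2 / ζ) *
            (Real.exp (2 * |z.re|) * Real.exp (-(Real.pi / ζ) * |z.re|)) := by ring
        _ = _ := by rw [← Real.exp_add]; ring_nf)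
  have e0 : ∀ x : ℝ, polarQuotient ζ g x = g x * (rho ζ x : ℂ) - g c * (rho ζ x : ℂ) := by
    intro x
    rw [polarQuotient_of_ne hζ _ (hne _ (by simp; linarith)), crho_ofReal, sub_mul]
  have e1 : ∀ x : ℝ, polarQuotient ζ g (x + ζ * I) =
      g c * (rho ζ x : ℂ) - g (x + ζ * I) * (rho ζ x : ℂ) := by
    intro x
    rw [polarQuotient_of_ne hζ _ (hne _ (by simp; linarith)), crho_add_mul_I hζ, crho_ofReal]
    ring
  simp_rw [e0, e1] at hshift
  rw [integral_sub hi0 hir, integral_sub hir hi1, hcr] at hshift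
  linear_combination hshift

lemma integrable_mul_rho {ζ : ℝ} (hζ : 0 < ζ) (hζ1 : ζ < Real.pi / 2) {f : ℝ → ℂ}
    (hf : Continuous f) {C : ℝ} (hb : ∀ x, ‖f x‖ ≤ C * Real.exp (2 * |x|)) :
    Integrable fun x => f x * (rho ζ x : ℂ) :=
  integrable_of_norm_le_exp (C := C / ζ) (δ := Real.pi / ζ - 2)
    (hf.mul (Complex.continuous_ofReal.comp (continuous_rho hζ)))
    (by linarith [two_lt_pi_div hζ hζ1]) fun x _ => norm_mul_rho_le hζ (hb x)

lemma integrable_cosh_mul_rho_sq {ζ : ℝ} (hζ : 0 < ζ) (hζ1 : ζ < Real.pi / 2) :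
    Integrable fun x : ℝ => Complex.cosh (2 * x) * (rho ζ x : ℂ) * (rho ζ x : ℂ) := by
  refine integrable_mul_rho hζ hζ1 (C := 1 / ζ) ?_ fun x => ?_
  · exact Continuous.mul (by fun_prop) (Complex.continuous_ofReal.comp (continuous_rho hζ))
  · rw [norm_mul, Complex.norm_real, Real.norm_of_nonneg (rho_nonneg hζ x), mul_comm]
    have : Complex.cosh (2 * x) = ((Real.cosh (2 * x) : ℝ) : ℂ) := by push_cast; rfl
    rw [this, Complex.norm_real, Real.norm_of_nonneg (Real.cosh_pos _).le]
    have h := cosh_le_exp_abs (2 * x)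
    rw [abs_mul, abs_of_pos (two_pos : (0 : ℝ) < 2)] at h
    exact mul_le_mul (rho_le_inv hζ x) h (Real.cosh_pos _).le (by positivity)

lemma integral_cosh_mul_rho_sq {ζ : ℝ} (hζ : 0 < ζ) (hζ1 : ζ < Real.pi / 2) :
    ∫ x : ℝ, Complex.cosh (2 * x) * (rho ζ x : ℂ) * (rho ζ x : ℂ) =
      1 / (2 * Real.pi * Real.sin ζ) := by
  set g : ℂ → ℂ := fun z => Complex.sinh (2 * z - ζ * I) - (2 * z - ζ * I) with hg
  have hgd : Differentiable ℂ g := by fun_prop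
  have hcenter : (2 : ℂ) * (ζ / 2 * I) - ζ * I = 0 := by ring
  have hgc : g (ζ / 2 * I) = 0 := by simp only [hg, hcenter, Complex.sinh_zero, sub_zero]
  have hdc : deriv g (ζ / 2 * I) = 0 := by
    have h1 : HasDerivAt (fun z : ℂ => 2 * z - ζ * I) 2 (ζ / 2 * I) := by
      simpa using ((hasDerivAt_id ((ζ : ℂ) / 2 * I)).const_mul 2).sub_const ((ζ : ℂ) * I)
    have h2 := h1.csinh.sub h1
    rw [hcenter, Complex.cosh_zero, one_mul, sub_self] at h2
    exact h2.deriv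
  have key := integral_rho_mul_add_shift hζ hζ1 (g := polarQuotient ζ g)
    (C := (2 + ζ) * (2 / ζ))
    (fun z h0 h1 => differentiableAt_polarQuotient hζ (fun w _ _ => hgd w) h0 h1) (by
      intro z h0 h1 hz
      rw [polarQuotient_of_ne hζ _ (by
        rintro rfl
        simp at hz
        norm_num at hz), hgc, sub_zero, norm_mul]
      have hre : (2 * z - ζ * I).re = 2 * z.re := by simp
      have him : (2 * z - ζ * I).im = 2 * z.im - ζ := by simp
      have hA : |2 * z.re| = 2 * |z.re| := by rw [abs_mul, abs_of_pos two_pos]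
      have hE : 2 * |z.re| + 1 ≤ Real.exp (2 * |z.re|) := Real.add_one_le_exp _
      have hs := norm_sinh_le_exp_abs_re (2 * z - ζ * I)
      have hl := Complex.norm_le_abs_re_add_abs_im (2 * z - ζ * I)
      rw [hre, hA] at hs hl
      have hi : |(2 * z - ζ * I).im| ≤ ζ := by rw [him, abs_le]; constructor <;> linarith
      have hgz : ‖g z‖ ≤ (2 + ζ) * Real.exp (2 * |z.re|) := by
        refine (norm_sub_le _ _).trans ?_
        nlinarith [abs_nonneg z.re]
      have hc := norm_crho_le hζ hζ1 hz
      have hexp : Real.exp (-(Real.pi / ζ) * |z.re|) ≤ 1 := by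
        refine Real.exp_le_one_iff.mpr ?_
        have : 0 ≤ Real.pi / ζ * |z.re| := by have := Real.pi_pos; positivity
        linarith
      calc ‖g z‖ * ‖crho ζ z‖ ≤ ((2 + ζ) * Real.exp (2 * |z.re|)) * (2 / ζ) := by
            gcongr
            exact hc.trans (mul_le_of_le_one_right (by positivity) hexp)
        _ = _ := by ring)
  rw [polarQuotient_center g hdc] at key
  have hne : ∀ z : ℂ, z.im ≠ ζ / 2 → z ≠ ζ / 2 * I := by
    rintro z hz rfl
    simp at hz
  have e0 : ∀ x : ℝ, polarQuotient ζ g x * (rho ζ x : ℂ) = g x * (rho ζ x : ℂ) * (rho ζ x : ℂ) := by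
    intro x
    rw [polarQuotient_of_ne hζ _ (hne _ (by simp; linarith)), crho_ofReal, hgc, sub_zero]
  have e1 : ∀ x : ℝ, polarQuotient ζ g (x + ζ * I) * (rho ζ x : ℂ) =
      g x * (rho ζ x : ℂ) * (rho ζ x : ℂ) * (-1) +
      2 * I * Complex.sin ζ * (-1) * (Complex.cosh (2 * x) * (rho ζ x : ℂ) * (rho ζ x : ℂ)) +
      2 * I * ζ * (((rho ζ x ^ 2 : ℝ)) : ℂ) := by
    intro x
    rw [polarQuotient_of_ne hζ _ (hne _ (by simp; linarith)), crho_add_mul_I hζ, crho_ofReal,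
      hgc, sub_zero]
    simp only [hg]
    have h1 : (2 : ℂ) * (x + ζ * I) - ζ * I = 2 * x + ζ * I := by ring
    rw [h1, Complex.sinh_add, Complex.sinh_sub, Complex.cosh_mul_I, Complex.sinh_mul_I]
    push_cast
    ring
  have hgi : Integrable fun x : ℝ => g x * (rho ζ x : ℂ) * (rho ζ x : ℂ) := by
    refine integrable_mul_rho hζ hζ1 (C := (2 + ζ) * (1 / ζ)) ?_ fun x => ?_
    · exact (hgd.continuous.comp Complex.continuous_ofReal).mul
        (Complex.continuous_ofReal.comp (continuous_rho hζ))
    · have hre : (2 * (x : ℂ) - ζ * I).re = 2 * x := by simp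
      have him : (2 * (x : ℂ) - ζ * I).im = - ζ := by simp
      have hA : |2 * x| = 2 * |x| := by rw [abs_mul, abs_of_pos two_pos]
      have hE : 2 * |x| + 1 ≤ Real.exp (2 * |x|) := Real.add_one_le_exp _
      have hs := norm_sinh_le_exp_abs_re (2 * (x : ℂ) - ζ * I)
      have hl := Complex.norm_le_abs_re_add_abs_im (2 * (x : ℂ) - ζ * I)
      rw [hre, hA] at hs hl
      rw [him, abs_neg, abs_of_pos hζ] at hl
      have hgz : ‖g x‖ ≤ (2 + ζ) * Real.exp (2 * |x|) := by
        refine (norm_sub_le _ _).trans ?_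
        nlinarith [abs_nonneg x]
      rw [norm_mul, Complex.norm_real, Real.norm_of_nonneg (rho_nonneg hζ x)]
      calc ‖g x‖ * rho ζ x ≤ ((2 + ζ) * Real.exp (2 * |x|)) * (1 / ζ) :=
            mul_le_mul hgz (rho_le_inv hζ x) (rho_nonneg hζ x) (by positivity)
        _ = _ := by ring
  have hci := integrable_cosh_mul_rho_sq hζ hζ1
  have hri : Integrable fun x => ((rho ζ x ^ 2 : ℝ) : ℂ) := (integrable_rho_sq hζ).ofReal
  simp_rw [e0, e1] at key
  have hsum := (hgi.mul_const (-1)).add (hci.const_mul (2 * I * Complex.sin ζ * (-1)))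
  simp only [Pi.add_def] at hsum
  rw [integral_add hsum (hri.const_mul _),
    integral_add (hgi.mul_const _) (hci.const_mul _), integral_mul_const, integral_const_mul,
    integral_const_mul, integral_complex_ofReal, integral_rho_sq hζ] at key
  have hs : Complex.sin ζ ≠ 0 := by
    rw [← Complex.ofReal_sin]
    exact_mod_cast (Real.sin_pos_of_pos_of_lt_pi hζ (by linarith [Real.pi_pos])).ne'
  have hζ' : (ζ : ℂ) ≠ 0 := by exact_mod_cast hζ.ne'
  have hpi : (Real.pi : ℂ) ≠ 0 := by exact_mod_cast Real.pi_ne_zero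
  push_cast at key ⊢
  generalize (∫ x : ℝ, Complex.cosh (2 * x) * (rho ζ x : ℂ) * (rho ζ x : ℂ)) = P at key ⊢
  generalize (∫ x : ℝ, g x * (rho ζ x : ℂ) * (rho ζ x : ℂ)) = Q at key
  rw [eq_div_iff (by simp [hs, hpi])]
  field_simp at key
  refine mul_left_cancel₀ Complex.I_ne_zero ?_
  linear_combination -key

/-! ### Double integrals against the kernel `1 / sinh` -/

/-- The weight `sinh (x + iα) ρ(x)`. -/
noncomputable def sinhRho (ζ α x : ℝ) : ℂ := Complex.sinh (x + α * I) * (rho ζ x : ℂ)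

/-- The double integral of `u(a) v(b) / sinh (b - a + iy)`. -/
noncomputable def doubleIntegral (u v : ℝ → ℂ) (y : ℝ) : ℂ :=
  ∫ a : ℝ, ∫ b : ℝ, u a * v b / Complex.sinh ((b : ℂ) - a + y * I)

lemma norm_sinh_add_mul_I_le (α : ℝ) (z : ℂ) :
    ‖Complex.sinh (z + α * I)‖ ≤ Real.exp |z.re| := by
  simpa using norm_sinh_le_exp_abs_re (z + α * I)

lemma continuous_sinhRho {ζ : ℝ} (hζ : 0 < ζ) (α : ℝ) : Continuous (sinhRho ζ α) :=
  Continuous.mul (by fun_prop) (Complex.continuous_ofReal.comp (continuous_rho hζ))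

lemma integrable_sinhRho {ζ : ℝ} (hζ : 0 < ζ) (hζ1 : ζ < Real.pi / 2) (α : ℝ) :
    Integrable (sinhRho ζ α) := by
  refine integrable_mul_rho hζ hζ1 (C := 1) (by fun_prop) fun x => ?_
  refine (norm_sinh_add_mul_I_le α x).trans ?_
  rw [one_mul, Complex.ofReal_re]
  exact Real.exp_le_exp.mpr (by linarith [abs_nonneg x])

lemma norm_sinhRho_le {ζ : ℝ} (hζ : 0 < ζ) (hζ1 : ζ < Real.pi / 2) (α x : ℝ) :
    ‖sinhRho ζ α x‖ ≤ 1 / ζ := by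
  have hw : ‖Complex.sinh ((x : ℂ) + α * I)‖ ≤ 1 * Real.exp (2 * |x|) := by
    refine (norm_sinh_add_mul_I_le α x).trans ?_
    rw [one_mul, Complex.ofReal_re]
    exact Real.exp_le_exp.mpr (by linarith [abs_nonneg x])
  refine (norm_mul_rho_le hζ hw).trans (mul_le_of_le_one_right (by positivity) ?_)
  refine Real.exp_le_one_iff.mpr ?_
  nlinarith [abs_nonneg x, two_lt_pi_div hζ hζ1]

lemma sinh_ne_zero_of_sin_im_ne_zero {z : ℂ} (hz : Real.sin z.im ≠ 0) : Complex.sinh z ≠ 0 :=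
  norm_pos_iff.mp ((abs_pos.mpr hz).trans_le (abs_sin_im_le_norm_sinh z))

lemma norm_inv_sinh_le {z : ℂ} {m : ℝ} (hm : 0 < m) (hz : m ≤ Real.sin z.im) :
    ‖(Complex.sinh z)⁻¹‖ ≤ m⁻¹ := by
  rw [norm_inv]
  exact inv_anti₀ hm (hz.trans ((le_abs_self _).trans (abs_sin_im_le_norm_sinh z)))

lemma norm_inv_sinh_le_of_ne {z : ℂ} (hz : Real.sin z.im ≠ 0) :
    ‖(Complex.sinh z)⁻¹‖ ≤ |Real.sin z.im|⁻¹ := by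
  rw [norm_inv]
  exact inv_anti₀ (abs_pos.mpr hz) (abs_sin_im_le_norm_sinh z)

lemma integrable_kernel {u v : ℝ → ℂ} (hu : Integrable u) (hv : Integrable v) {y : ℝ}
    (hy : Real.sin y ≠ 0) :
    Integrable (fun p : ℝ × ℝ => u p.1 * v p.2 / Complex.sinh ((p.2 : ℂ) - p.1 + y * I))
      (volume.prod volume) := by
  simp_rw [div_eq_mul_inv]
  have hsin : ∀ p : ℝ × ℝ, Real.sin ((p.2 : ℂ) - p.1 + y * I).im ≠ 0 := by simpa using hy
  refine (hu.mul_prod hv).mul_bdd (c := |Real.sin y|⁻¹) ?_ (Eventually.of_forall fun p => ?_)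
  · refine Continuous.aestronglyMeasurable ?_
    exact Continuous.inv₀ (by fun_prop) fun p => sinh_ne_zero_of_sin_im_ne_zero (hsin p)
  · simpa using norm_inv_sinh_le_of_ne (hsin p)

lemma integrable_kernel_right {v : ℝ → ℂ} (hv : Integrable v) (a : ℝ) (w : ℂ) {y : ℝ}
    (hy : Real.sin y ≠ 0) :
    Integrable fun b : ℝ => w * v b / Complex.sinh ((b : ℂ) - a + y * I) := by
  simp_rw [div_eq_mul_inv]
  have hsin : ∀ b : ℝ, Real.sin ((b : ℂ) - a + y * I).im ≠ 0 := by simpa using hy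
  refine (hv.const_mul w).mul_bdd (c := |Real.sin y|⁻¹) ?_ (Eventually.of_forall fun b => ?_)
  · refine Continuous.aestronglyMeasurable ?_
    exact Continuous.inv₀ (by fun_prop) fun b => sinh_ne_zero_of_sin_im_ne_zero (hsin b)
  · simpa using norm_inv_sinh_le_of_ne (hsin b)

lemma min_sin_le_sin {s t y : ℝ} (h0 : 0 < s) (hst : s ≤ t) (h1 : t < Real.pi)
    (hy0 : s ≤ y) (hy1 : y ≤ t) : min (Real.sin s) (Real.sin t) ≤ Real.sin y :=
  strictConcaveOn_sin_Icc.concaveOn.min_le_of_mem_Icc ⟨h0.le, by linarith⟩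
    ⟨by linarith, h1.le⟩ ⟨hy0, hy1⟩

lemma min_sin_pos {s t : ℝ} (h0 : 0 < s) (hst : s ≤ t) (h1 : t < Real.pi) :
    0 < min (Real.sin s) (Real.sin t) :=
  lt_min (Real.sin_pos_of_pos_of_lt_pi h0 (by linarith))
    (Real.sin_pos_of_pos_of_lt_pi (by linarith) h1)

lemma norm_sinh_div_sinh_le (α : ℝ) {z w : ℂ} {m : ℝ} (hm : 0 < m) (hw : m ≤ Real.sin w.im) :
    ‖Complex.sinh (z + α * I) / Complex.sinh w‖ ≤ m⁻¹ * Real.exp (2 * |z.re|) := by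
  rw [div_eq_mul_inv, norm_mul, mul_comm]
  have h1 : ‖Complex.sinh (z + α * I)‖ ≤ Real.exp (2 * |z.re|) :=
    (norm_sinh_add_mul_I_le α z).trans (Real.exp_le_exp.mpr (by linarith [abs_nonneg z.re]))
  exact mul_le_mul (norm_inv_sinh_le hm hw) h1 (norm_nonneg _) (by positivity)

/-- Shifting the second variable: the zero of `sinh` cancels the pole of the density. -/
lemma doubleIntegral_shift_right {ζ : ℝ} (hζ : 0 < ζ) (hζ1 : ζ < Real.pi / 2) (u : ℝ → ℂ) {y : ℝ}
    (hy0 : 0 < y) (hy1 : y + ζ < Real.pi) :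
    doubleIntegral u (sinhRho ζ (ζ / 2)) (y + ζ) =
      -doubleIntegral u (sinhRho ζ (-(ζ / 2))) y := by
  rw [doubleIntegral, doubleIntegral, ← integral_neg]
  congr 1
  ext a
  have hm := min_sin_pos hy0 (by linarith) hy1
  have him : ∀ z : ℂ, (z - a + y * I).im = y + z.im := fun z => by simp [add_comm]
  have hsin : ∀ z : ℂ, 0 ≤ z.im → z.im ≤ ζ →
      min (Real.sin y) (Real.sin (y + ζ)) ≤ Real.sin (z - a + y * I).im := by
    intro z h0 h1
    rw [him]
    exact min_sin_le_sin hy0 (by linarith) hy1 (by linarith) (by linarith)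
  have key := integral_rho_mul_add_shift hζ hζ1
    (g := fun z => Complex.sinh (z + (-(ζ / 2) : ℝ) * I) / Complex.sinh (z - a + y * I))
    (C := (min (Real.sin y) (Real.sin (y + ζ)))⁻¹)
    (fun z h0 h1 => DifferentiableAt.div (by fun_prop) (by fun_prop)
      (sinh_ne_zero_of_sin_im_ne_zero (hm.trans_le (hsin z h0 h1)).ne'))
    (fun z h0 h1 _ => norm_sinh_div_sinh_le _ hm (hsin z h0 h1))
  have hc : (ζ : ℂ) / 2 * I + (-(ζ / 2) : ℝ) * I = 0 := by push_cast; ring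
  simp only [hc, Complex.sinh_zero, zero_div] at key
  have e1 : ∀ b : ℝ, u a * sinhRho ζ (ζ / 2) b / Complex.sinh ((b : ℂ) - a + (y + ζ : ℝ) * I) =
      u a * (Complex.sinh (b + ζ * I + (-(ζ / 2) : ℝ) * I) /
        Complex.sinh (b + ζ * I - a + y * I) * (rho ζ b : ℂ)) := by
    intro b
    rw [sinhRho, show (b : ℂ) - a + (y + ζ : ℝ) * I = b + ζ * I - a + y * I by push_cast; ring,
      show (b : ℂ) + (ζ / 2 : ℝ) * I = b + ζ * I + (-(ζ / 2) : ℝ) * I by push_cast; ring]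
    ring
  have e2 : ∀ b : ℝ, u a * sinhRho ζ (-(ζ / 2)) b / Complex.sinh ((b : ℂ) - a + y * I) =
      u a * (Complex.sinh (b + (-(ζ / 2) : ℝ) * I) /
        Complex.sinh (b - a + y * I) * (rho ζ b : ℂ)) := by
    intro b
    rw [sinhRho]
    ring
  simp_rw [e1, e2, integral_const_mul]
  linear_combination u a * key

lemma doubleIntegral_swap {u v : ℝ → ℂ} (hu : Integrable u) (hv : Integrable v) {y : ℝ}
    (hy : Real.sin y ≠ 0) : doubleIntegral u v y =
      ∫ b : ℝ, ∫ a : ℝ, u a * v b / Complex.sinh ((b : ℂ) - a + y * I) :=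
  integral_integral_swap (integrable_kernel hu hv hy)

/-- Shifting the first variable across the pole of the density. -/
lemma doubleIntegral_shift_left {ζ : ℝ} (hζ : 0 < ζ) (hζ1 : ζ < Real.pi / 2) (α : ℝ) {v : ℝ → ℂ}
    (hv : Integrable v) {y : ℝ} (hy0 : 0 < y) (hy1 : y + ζ < Real.pi) :
    doubleIntegral (sinhRho ζ (α - ζ)) v (y + ζ) =
      Complex.sinh ((α - ζ / 2 : ℝ) * I) *
        (∫ b : ℝ, v b / Complex.sinh (b + (y + ζ / 2 : ℝ) * I)) -
      doubleIntegral (sinhRho ζ α) v y := by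
  have hsy : Real.sin y ≠ 0 := (Real.sin_pos_of_pos_of_lt_pi hy0 (by linarith)).ne'
  have hsyζ : Real.sin (y + ζ) ≠ 0 := (Real.sin_pos_of_pos_of_lt_pi (by linarith) hy1).ne'
  have hsm : Real.sin (y + ζ / 2) ≠ 0 :=
    (Real.sin_pos_of_pos_of_lt_pi (by linarith) (by linarith)).ne'
  rw [doubleIntegral_swap (integrable_sinhRho hζ hζ1 _) hv hsyζ,
    doubleIntegral_swap (integrable_sinhRho hζ hζ1 _) hv hsy, ← integral_const_mul,
    ← integral_sub]
  rotate_left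
  · have := integrable_kernel_right hv 0 (Complex.sinh ((α - ζ / 2 : ℝ) * I)) hsm
    simpa [mul_div_assoc] using this
  · exact (integrable_kernel (integrable_sinhRho hζ hζ1 _) hv hsy).integral_prod_right
  congr 1
  ext b
  have hm := min_sin_pos hy0 (by linarith) hy1
  have hsin : ∀ z : ℂ, 0 ≤ z.im → z.im ≤ ζ →
      min (Real.sin y) (Real.sin (y + ζ)) ≤ Real.sin (b - z + (y + ζ : ℝ) * I).im := by
    intro z h0 h1
    have him : (b - z + (y + ζ : ℝ) * I).im = y + ζ - z.im := by simp; ring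
    rw [him]
    exact min_sin_le_sin hy0 (by linarith) hy1 (by linarith) (by linarith)
  have key := integral_rho_mul_add_shift hζ hζ1
    (g := fun z => Complex.sinh (z + (α - ζ : ℝ) * I) / Complex.sinh (b - z + (y + ζ : ℝ) * I))
    (C := (min (Real.sin y) (Real.sin (y + ζ)))⁻¹)
    (fun z h0 h1 => DifferentiableAt.div (by fun_prop) (by fun_prop)
      (sinh_ne_zero_of_sin_im_ne_zero (hm.trans_le (hsin z h0 h1)).ne'))
    (fun z h0 h1 _ => norm_sinh_div_sinh_le _ hm (hsin z h0 h1))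
  have hc1 : (ζ : ℂ) / 2 * I + (α - ζ : ℝ) * I = (α - ζ / 2 : ℝ) * I := by push_cast; ring
  have hc2 : (b : ℂ) - ζ / 2 * I + (y + ζ : ℝ) * I = b + (y + ζ / 2 : ℝ) * I := by
    push_cast; ring
  simp only [hc1, hc2] at key
  have e1 : ∀ a : ℝ, sinhRho ζ α a * v b / Complex.sinh ((b : ℂ) - a + y * I) =
      v b * (Complex.sinh (a + ζ * I + (α - ζ : ℝ) * I) /
        Complex.sinh (b - (a + ζ * I) + (y + ζ : ℝ) * I) * (rho ζ a : ℂ)) := by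
    intro a
    rw [sinhRho, show (b : ℂ) - (a + ζ * I) + (y + ζ : ℝ) * I = b - a + y * I by push_cast; ring,
      show (a : ℂ) + ζ * I + (α - ζ : ℝ) * I = a + α * I by push_cast; ring]
    ring
  have e2 : ∀ a : ℝ, sinhRho ζ (α - ζ) a * v b / Complex.sinh ((b : ℂ) - a + (y + ζ : ℝ) * I) =
      v b * (Complex.sinh (a + (α - ζ : ℝ) * I) /
        Complex.sinh (b - a + (y + ζ : ℝ) * I) * (rho ζ a : ℂ)) := by
    intro a
    rw [sinhRho]
    ring
  simp_rw [e1, e2, integral_const_mul]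
  linear_combination v b * key

/-- Continuity in the height of the pole, away from the real axis. -/
lemma tendsto_integral_div_sinh {v : ℝ → ℂ} (hv : Integrable v) {y : ℝ} (hy0 : 0 < y)
    (hy1 : y < Real.pi) :
    Tendsto (fun ε : ℝ => ∫ b : ℝ, v b / Complex.sinh (b + (ε + y : ℝ) * I)) (𝓝[>] 0)
      (𝓝 (∫ b : ℝ, v b / Complex.sinh (b + y * I))) := by
  have hy2 : y < (y + Real.pi) / 2 := by linarith
  have hm := min_sin_pos hy0 hy2.le (by linarith)
  refine tendsto_integral_filter_of_dominated_convergence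
    (fun b => ‖v b‖ * (min (Real.sin y) (Real.sin ((y + Real.pi) / 2)))⁻¹) ?_ ?_
    (hv.norm.mul_const _) ?_
  · refine Eventually.of_forall fun ε => ?_
    simp_rw [div_eq_mul_inv]
    refine hv.aestronglyMeasurable.mul (Measurable.aestronglyMeasurable ?_)
    exact (Continuous.measurable (by fun_prop)).inv
  · have : ∀ᶠ ε : ℝ in 𝓝[>] 0, ε < (Real.pi - y) / 2 :=
      nhdsWithin_le_nhds (gt_mem_nhds (by linarith))
    filter_upwards [this, self_mem_nhdsWithin] with ε h1 h0
    have h0 : 0 < ε := h0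
    refine Eventually.of_forall fun b => ?_
    rw [div_eq_mul_inv, norm_mul]
    gcongr
    refine norm_inv_sinh_le hm ?_
    have : ((b : ℂ) + (ε + y : ℝ) * I).im = ε + y := by simp
    rw [this]
    exact min_sin_le_sin hy0 hy2.le (by linarith) (by linarith) (by linarith)
  · refine Eventually.of_forall fun b => ?_
    refine Tendsto.div tendsto_const_nhds ?_ ?_
    · refine tendsto_nhdsWithin_of_tendsto_nhds ?_
      have : Continuous fun ε : ℝ => Complex.sinh (b + (ε + y : ℝ) * I) := by fun_prop
      simpa using this.tendsto 0
    · refine sinh_ne_zero_of_sin_im_ne_zero ?_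
      simpa using (Real.sin_pos_of_pos_of_lt_pi hy0 hy1).ne'

/-! ### The jump of the kernel across the real axis -/

lemma inv_sinh_sub_inv_sinh {x ε : ℝ} (hε : Real.sin ε ≠ 0) :
    1 / Complex.sinh (x + ε * I) - 1 / Complex.sinh (x + (-ε : ℝ) * I) =
      -2 * I * ((Real.cosh x * Real.sin ε / (Real.sinh x ^ 2 + Real.sin ε ^ 2) : ℝ) : ℂ) := by
  have h1 : Complex.sinh (x + ε * I) ≠ 0 := sinh_ne_zero_of_sin_im_ne_zero (by simpa using hε)
  have h2 : Complex.sinh (x + (-ε : ℝ) * I) ≠ 0 :=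
    sinh_ne_zero_of_sin_im_ne_zero (by simpa using hε)
  have h3 : (Complex.sinh x ^ 2 + Complex.sin ε ^ 2) ≠ 0 := by
    have : 0 < Real.sinh x ^ 2 + Real.sin ε ^ 2 := by positivity
    exact_mod_cast this.ne'
  have hprod : Complex.sinh (x + ε * I) * Complex.sinh (x + (-ε : ℝ) * I) =
      Complex.sinh x ^ 2 + Complex.sin ε ^ 2 := by
    rw [Complex.sinh_add, Complex.sinh_add, Complex.cosh_mul_I, Complex.sinh_mul_I,
      Complex.cosh_mul_I, Complex.sinh_mul_I]
    push_cast
    rw [Complex.cos_neg, Complex.sin_neg]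
    linear_combination Complex.sinh x ^ 2 * Complex.sin_sq_add_cos_sq (ε : ℂ)
      + Complex.sin ε ^ 2 * Complex.cosh_sq (x : ℂ)
      - Complex.cosh x ^ 2 * Complex.sin ε ^ 2 * Complex.I_sq
  rw [div_sub_div _ _ h1 h2, hprod, one_mul, mul_one, Complex.sinh_add, Complex.sinh_add,
    Complex.cosh_mul_I, Complex.sinh_mul_I, Complex.cosh_mul_I, Complex.sinh_mul_I]
  push_cast
  rw [Complex.cos_neg, Complex.sin_neg]
  ring

/-- The substitution `t = sinh (b - a) / s`. -/
lemma integral_cosh_kernel (v : ℝ → ℂ) (a : ℝ) {s : ℝ} (hs : 0 < s) :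
    ∫ b : ℝ, v b * ((Real.cosh (b - a) * s / (Real.sinh (b - a) ^ 2 + s ^ 2) : ℝ) : ℂ) =
      ∫ t : ℝ, v (a + Real.arsinh (s * t)) * (((1 + t ^ 2)⁻¹ : ℝ) : ℂ) := by
  have hd : ∀ b ∈ Set.univ, HasDerivWithinAt (fun b : ℝ => Real.sinh (b - a) / s)
      (Real.cosh (b - a) / s) Set.univ b := by
    intro b _
    have := (((hasDerivAt_id b).sub_const a).sinh).div_const s
    simpa using this
  have hinj : Set.InjOn (fun b : ℝ => Real.sinh (b - a) / s) Set.univ := by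
    intro b _ b' _ h
    have h' : Real.sinh (b - a) / s = Real.sinh (b' - a) / s := h
    rw [div_left_inj' hs.ne', Real.sinh_inj] at h'
    linarith
  have himg : (fun b : ℝ => Real.sinh (b - a) / s) '' Set.univ = Set.univ := by
    rw [Set.image_univ, Set.range_eq_univ]
    intro t
    refine ⟨a + Real.arsinh (s * t), ?_⟩
    simp only [add_sub_cancel_left, Real.sinh_arsinh]
    field_simp
  have key := integral_image_eq_integral_abs_deriv_smul MeasurableSet.univ hd hinj
    (fun t => v (a + Real.arsinh (s * t)) * (((1 + t ^ 2)⁻¹ : ℝ) : ℂ))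
  rw [himg, setIntegral_univ, setIntegral_univ] at key
  rw [key]
  congr 1
  ext b
  have e1 : s * (Real.sinh (b - a) / s) = Real.sinh (b - a) := by field_simp
  have hc := Real.cosh_pos (b - a)
  rw [e1, Real.arsinh_sinh, add_sub_cancel, abs_of_pos (by positivity), Complex.real_smul,
    mul_left_comm, ← Complex.ofReal_mul]
  congr 2
  field_simp
  rw [add_comm]

/-- The jump of `doubleIntegral` across `y = 0` is a delta function on the diagonal. -/
lemma tendsto_doubleIntegral_sub {u v : ℝ → ℂ} (hu : Integrable u) (hv : Integrable v)
    (hvc : Continuous v) {M : ℝ} (hM : ∀ x, ‖v x‖ ≤ M) :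
    Tendsto (fun ε : ℝ => doubleIntegral u v ε - doubleIntegral u v (-ε)) (𝓝[>] 0)
      (𝓝 (-2 * Real.pi * I * ∫ a : ℝ, u a * v a)) := by
  set δ : ℝ → ℝ → ℂ := fun ε a =>
    ∫ t : ℝ, v (a + Real.arsinh (Real.sin ε * t)) * (((1 + t ^ 2)⁻¹ : ℝ) : ℂ) with hδ
  have hw : Integrable fun t : ℝ => M * (1 + t ^ 2)⁻¹ := integrable_inv_one_add_sq.const_mul M
  have hbound : ∀ ε a t : ℝ, ‖v (a + Real.arsinh (Real.sin ε * t)) * (((1 + t ^ 2)⁻¹ : ℝ) : ℂ)‖ ≤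
      M * (1 + t ^ 2)⁻¹ := by
    intro ε a t
    rw [norm_mul, Complex.norm_real, Real.norm_of_nonneg (by positivity)]
    exact mul_le_mul_of_nonneg_right (hM _) (by positivity)
  have hcont : Continuous fun p : ℝ × ℝ × ℝ =>
      v (p.2.1 + Real.arsinh (Real.sin p.1 * p.2.2)) * (((1 + p.2.2 ^ 2)⁻¹ : ℝ) : ℂ) := by
    refine (hvc.comp ?_).mul (Complex.continuous_ofReal.comp (Continuous.inv₀ (by fun_prop) ?_))
    · exact continuous_snd.fst.add (Real.continuous_arsinh.comp (by fun_prop))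
    · intro p; positivity
  have hδc : Continuous fun p : ℝ × ℝ => δ p.1 p.2 := by
    refine continuous_of_dominated (bound := fun t => M * (1 + t ^ 2)⁻¹) (fun p => ?_)
      (fun p => Eventually.of_forall (hbound p.1 p.2)) hw (Eventually.of_forall fun t => ?_)
    · exact (hcont.comp (by fun_prop : Continuous fun t : ℝ => (p.1, p.2, t))).aestronglyMeasurable
    · exact hcont.comp (by fun_prop : Continuous fun p : ℝ × ℝ => (p.1, p.2, t))
  have hδ0 : ∀ a, δ 0 a = v a * Real.pi := by
    intro a
    simp only [hδ, Real.sin_zero, zero_mul, Real.arsinh_zero, add_zero]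
    rw [integral_const_mul, integral_complex_ofReal, integral_univ_inv_one_add_sq]
  have hδb : ∀ ε a, ‖δ ε a‖ ≤ M * Real.pi := by
    intro ε a
    refine (norm_integral_le_of_norm_le hw (Eventually.of_forall (hbound ε a))).trans_eq ?_
    rw [integral_const_mul, integral_univ_inv_one_add_sq]
  have hlim : Tendsto (fun ε : ℝ => ∫ a : ℝ, u a * (-2 * I * δ ε a)) (𝓝[>] 0)
      (𝓝 (∫ a : ℝ, u a * (-2 * I * δ 0 a))) := by
    refine tendsto_integral_filter_of_dominated_convergence
      (fun a => ‖u a‖ * (2 * (M * Real.pi))) (Eventually.of_forall fun ε => ?_)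
      (Eventually.of_forall fun ε => Eventually.of_forall fun a => ?_) (hu.norm.mul_const _)
      (Eventually.of_forall fun a => ?_)
    · refine hu.aestronglyMeasurable.mul (Continuous.aestronglyMeasurable ?_)
      exact continuous_const.mul (hδc.comp (by fun_prop : Continuous fun a : ℝ => (ε, a)))
    · rw [norm_mul]
      gcongr
      simpa using hδb ε a
    · refine tendsto_nhdsWithin_of_tendsto_nhds ?_
      have : Continuous fun ε : ℝ => u a * (-2 * I * δ ε a) :=
        continuous_const.mul (continuous_const.mul
          (hδc.comp (by fun_prop : Continuous fun ε : ℝ => (ε, a))))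
      exact this.tendsto 0
  have hval : ∫ a : ℝ, u a * (-2 * I * δ 0 a) = -2 * Real.pi * I * ∫ a : ℝ, u a * v a := by
    rw [← integral_const_mul]
    congr 1
    ext a
    rw [hδ0]
    ring
  rw [← hval]
  refine hlim.congr' ?_
  have hpi : ∀ᶠ ε : ℝ in 𝓝[>] 0, ε < Real.pi := nhdsWithin_le_nhds (gt_mem_nhds Real.pi_pos)
  filter_upwards [hpi, self_mem_nhdsWithin] with ε h1 h0
  have hs : 0 < Real.sin ε := Real.sin_pos_of_pos_of_lt_pi h0 h1
  have hs' : Real.sin (-ε) ≠ 0 := by rw [Real.sin_neg]; exact neg_ne_zero.mpr hs.ne'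
  rw [doubleIntegral, doubleIntegral, ← integral_sub
    (integrable_kernel hu hv hs.ne').integral_prod_left
    (integrable_kernel hu hv hs').integral_prod_left]
  congr 1
  ext a
  dsimp only
  rw [← integral_sub (integrable_kernel_right hv a _ hs.ne') (integrable_kernel_right hv a _ hs'),
    hδ]
  simp only
  rw [← integral_cosh_kernel v a hs, ← integral_const_mul, ← integral_const_mul]
  congr 1
  ext b
  have := inv_sinh_sub_inv_sinh (x := b - a) hs.ne'
  rw [Complex.ofReal_sub b a] at this
  linear_combination -(u a * v b) * this

lemma sinh_mul_sinh_add_reflect (x p q : ℂ) :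
    Complex.sinh (x + p) * Complex.sinh (x + q) + Complex.sinh (-x + p) * Complex.sinh (-x + q) =
      Complex.cosh (2 * x) * Complex.cosh (p + q) - Complex.cosh (p - q) := by
  simp only [Complex.sinh_add, Complex.cosh_add, Complex.cosh_sub, Complex.cosh_two_mul,
    Complex.sinh_neg, Complex.cosh_neg]
  linear_combination (Complex.cosh p * Complex.cosh q - Complex.sinh p * Complex.sinh q) *
    Complex.cosh_sq_sub_sinh_sq x * (-1)

lemma integral_sinhRho_mul_sinhRho {ζ : ℝ} (hζ : 0 < ζ) (hζ1 : ζ < Real.pi / 2) (α β : ℝ) :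
    ∫ x : ℝ, sinhRho ζ α x * sinhRho ζ β x =
      (Complex.cos (α + β) / (2 * Real.pi * Complex.sin ζ) -
        Complex.cos (α - β) / (2 * Real.pi * ζ)) / 2 := by
  have hi : Integrable fun x : ℝ => sinhRho ζ α x * sinhRho ζ β x :=
    (integrable_sinhRho hζ hζ1 α).mul_bdd (continuous_sinhRho hζ β).aestronglyMeasurable
      (Eventually.of_forall (norm_sinhRho_le hζ hζ1 β))
  have hrefl := integral_neg_eq_self (fun x : ℝ => sinhRho ζ α x * sinhRho ζ β x) volume
  have hsum := integral_add hi hi.comp_neg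
  have e : ∀ x : ℝ, sinhRho ζ α x * sinhRho ζ β x + sinhRho ζ α (-x) * sinhRho ζ β (-x) =
      Complex.cos (α + β) * (Complex.cosh (2 * x) * (rho ζ x : ℂ) * (rho ζ x : ℂ)) -
        Complex.cos (α - β) * ((rho ζ x ^ 2 : ℝ) : ℂ) := by
    intro x
    have hrho : rho ζ (-x) = rho ζ x := by
      simp only [rho, mul_neg, neg_div, Real.cosh_neg]
    have h := sinh_mul_sinh_add_reflect x (α * I) (β * I)
    rw [← add_mul, ← sub_mul, Complex.cosh_mul_I, Complex.cosh_mul_I] at h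
    simp only [sinhRho, hrho]
    push_cast
    linear_combination (rho ζ x : ℂ) ^ 2 * h
  have hri : Integrable fun x => ((rho ζ x ^ 2 : ℝ) : ℂ) := (integrable_rho_sq hζ).ofReal
  simp_rw [e] at hsum
  rw [integral_sub ((integrable_cosh_mul_rho_sq hζ hζ1).const_mul _) (hri.const_mul _),
    integral_const_mul, integral_const_mul, integral_cosh_mul_rho_sq hζ hζ1,
    integral_complex_ofReal, integral_rho_sq hζ, hrefl] at hsum
  push_cast at hsum
  linear_combination -hsum / 2

/-- One-point function ⟨E^{1,1}⟩ of the integrable spin-1 XXZ chain: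
explicit evaluation of the multiple-integral representation. -/
theorem stmt1 (ζ : ℝ) (hζ0 : 0 < ζ) (hζ1 : ζ < Real.pi / 2)
    (η : ℂ) (hη : η = Complex.I * ζ)
    (K₁ K₂ : ℂ)
    (hK₁ : K₁ = ∫ x : ℝ, (rho ζ x : ℂ))
    (hK₂ : K₂ = -2 * (Real.cos ζ : ℂ) *
      ∫ x : ℝ, (rho ζ x : ℂ) *
        (Complex.sinh ((x : ℂ) - η / 2) / Complex.sinh ((x : ℂ) + η / 2)))
    (J₁ J₂ : ℝ → ℂ)
    (hJ₁ : ∀ ε : ℝ, J₁ ε =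
      -∫ x₁ : ℝ, ∫ x₂ : ℝ,
        Complex.sinh ((x₁ : ℂ) - 3 * η / 2) * Complex.sinh ((x₂ : ℂ) - η / 2) /
          (Complex.sinh η * Complex.sinh ((x₂ : ℂ) - (x₁ : ℂ) - Complex.I * (ε : ℂ))) *
          (rho ζ x₁ : ℂ) * (rho ζ x₂ : ℂ))
    (hJ₂ : ∀ ε : ℝ, J₂ ε =
      -∫ x₁ : ℝ, ∫ x₂ : ℝ,
        Complex.sinh ((x₁ : ℂ) - 5 * η / 2) * Complex.sinh ((x₂ : ℂ) + η / 2) /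
          (Complex.sinh η * Complex.sinh ((x₂ : ℂ) - (x₁ : ℂ) + 2 * η + Complex.I * (ε : ℂ))) *
          (rho ζ x₁ : ℂ) * (rho ζ x₂ : ℂ)) :
    Tendsto (fun ε : ℝ => 2 * (-K₁ + K₂ + J₁ ε - J₂ ε)) (nhdsWithin 0 (Set.Ioi 0))
      (nhds ((Real.cos ζ * (Real.sin ζ - ζ * Real.cos ζ) / (ζ * Real.sin ζ ^ 2) : ℝ) : ℂ)) := by

  have hπ := Real.pi_pos
  set u := sinhRho ζ (-(3 * ζ / 2)) with hu
  set v := sinhRho ζ (-(ζ / 2)) with hv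
  have hui : Integrable u := integrable_sinhRho hζ0 hζ1 _
  have hvi : Integrable v := integrable_sinhRho hζ0 hζ1 _
  have hsinpos : 0 < Real.sin ζ := Real.sin_pos_of_pos_of_lt_pi hζ0 (by linarith)
  have hsin : Complex.sin ζ ≠ 0 := by rw [← Complex.ofReal_sin]; exact_mod_cast hsinpos.ne'
  have hζ' : (ζ : ℂ) ≠ 0 := by exact_mod_cast hζ0.ne'
  have hπ' : (Real.pi : ℂ) ≠ 0 := by exact_mod_cast Real.pi_ne_zero
  have hsη : Complex.sinh η = Complex.sin ζ * I := by
    rw [hη, mul_comm, Complex.sinh_mul_I]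
  have hK₁' : K₁ = 1 / 2 := by
    rw [hK₁, integral_complex_ofReal, integral_rho hζ0]; norm_num
  have hK₂' : K₂ = -2 * Complex.cos ζ *
      ∫ b : ℝ, v b / Complex.sinh (b + (ζ / 2 : ℝ) * I) := by
    rw [hK₂, Complex.ofReal_cos]
    congr 2
    ext b
    rw [hv, sinhRho, show (b : ℂ) - η / 2 = b + (-(ζ / 2) : ℝ) * I by rw [hη]; push_cast; ring,
      show (b : ℂ) + η / 2 = b + (ζ / 2 : ℝ) * I by rw [hη]; push_cast; ring]
    ring
  have hJ₁' : ∀ ε : ℝ, J₁ ε = -(Complex.sin ζ * I)⁻¹ * doubleIntegral u v (-ε) := by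
    intro ε
    rw [hJ₁, doubleIntegral, neg_mul, ← integral_const_mul]
    simp_rw [← integral_const_mul]
    refine congrArg Neg.neg (integral_congr_ae (Eventually.of_forall fun a =>
      integral_congr_ae (Eventually.of_forall fun b => ?_)))
    dsimp only
    rw [hu, hv, sinhRho, sinhRho, hsη,
      show (a : ℂ) - 3 * η / 2 = a + (-(3 * ζ / 2) : ℝ) * I by rw [hη]; push_cast; ring,
      show (b : ℂ) - η / 2 = b + (-(ζ / 2) : ℝ) * I by rw [hη]; push_cast; ring,
      show (b : ℂ) - a - I * ε = b - a + (-ε : ℝ) * I by push_cast; ring,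
      div_eq_mul_inv, mul_inv]
    ring
  have hJ₂' : ∀ ε : ℝ, J₂ ε = -(Complex.sin ζ * I)⁻¹ *
      doubleIntegral (sinhRho ζ (-(3 * ζ / 2) - ζ)) (sinhRho ζ (ζ / 2)) (ε + ζ + ζ) := by
    intro ε
    rw [hJ₂, doubleIntegral, neg_mul, ← integral_const_mul]
    simp_rw [← integral_const_mul]
    refine congrArg Neg.neg (integral_congr_ae (Eventually.of_forall fun a =>
      integral_congr_ae (Eventually.of_forall fun b => ?_)))
    dsimp only
    rw [sinhRho, sinhRho, hsη,
      show (a : ℂ) - 5 * η / 2 = a + (-(3 * ζ / 2) - ζ : ℝ) * I by rw [hη]; push_cast; ring,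
      show (b : ℂ) + η / 2 = b + (ζ / 2 : ℝ) * I by rw [hη]; push_cast; ring,
      show (b : ℂ) - a + 2 * η + I * ε = b - a + (ε + ζ + ζ : ℝ) * I by
        rw [hη]; push_cast; ring,
      div_eq_mul_inv, mul_inv]
    ring
  have hdelta := tendsto_doubleIntegral_sub hui hvi (continuous_sinhRho hζ0 _)
    (norm_sinhRho_le hζ0 hζ1 _)
  have hline := tendsto_integral_div_sinh hvi (y := ζ / 2) (by linarith) (by linarith)
  have hlim := ((((hline.const_mul (2 * Complex.cos ζ)).const_add (-K₁ + K₂)).add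
    (hdelta.const_mul (Complex.sin ζ * I)⁻¹)).const_mul 2)
  have hval : 2 * (-K₁ + K₂ + 2 * Complex.cos ζ *
        (∫ b : ℝ, v b / Complex.sinh (b + (ζ / 2 : ℝ) * I)) +
        (Complex.sin ζ * I)⁻¹ * (-2 * Real.pi * I * ∫ a : ℝ, u a * v a)) =
      ((Real.cos ζ * (Real.sin ζ - ζ * Real.cos ζ) / (ζ * Real.sin ζ ^ 2) : ℝ) : ℂ) := by
    rw [hK₁', hK₂', hu, hv, integral_sinhRho_mul_sinhRho hζ0 hζ1]
    have e1 : ((-(3 * ζ / 2) : ℝ) : ℂ) + (-(ζ / 2) : ℝ) = -(2 * ζ) := by push_cast; ring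
    have e2 : ((-(3 * ζ / 2) : ℝ) : ℂ) - (-(ζ / 2) : ℝ) = -ζ := by push_cast; ring
    rw [e1, e2, Complex.cos_neg, Complex.cos_neg, Complex.cos_two_mul]
    push_cast
    have hI := Complex.I_ne_zero
    field_simp
    linear_combination (-ζ : ℂ) * Complex.sin_sq_add_cos_sq (ζ : ℂ)
  rw [hval] at hlim
  refine hlim.congr' ?_
  have hsmall : ∀ᶠ ε : ℝ in 𝓝[>] 0, ε < Real.pi - 2 * ζ :=
    nhdsWithin_le_nhds (gt_mem_nhds (by linarith))
  filter_upwards [hsmall, self_mem_nhdsWithin] with ε h1 h0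
  have h0 : 0 < ε := h0
  rw [hJ₁', hJ₂', doubleIntegral_shift_right hζ0 hζ1 _ (by linarith) (by linarith), ← hv,
    doubleIntegral_shift_left hζ0 hζ1 _ hvi h0 (by linarith), ← hu]
  have e3 : Complex.sinh ((-(3 * ζ / 2) - ζ / 2 : ℝ) * I) =
      -2 * Complex.cos ζ * (Complex.sin ζ * I) := by
    rw [Complex.sinh_mul_I, show ((-(3 * ζ / 2) - ζ / 2 : ℝ) : ℂ) = -(2 * ζ) by push_cast; ring,
      Complex.sin_neg, Complex.sin_two_mul]
    ring
  rw [e3]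
  have hsI : Complex.sin ζ * I ≠ 0 := mul_ne_zero hsin Complex.I_ne_zero
  linear_combination (-4 : ℂ) * Complex.cos ζ *
    (∫ b : ℝ, v b / Complex.sinh (b + (ε + ζ / 2 : ℝ) * I)) * mul_inv_cancel₀ hsI
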